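/- Let n ≥ 1, let B : Fin n → Fin n → ℝ∪{−∞} satisfy Tr(B) ≤ 0, let p : Fin n → ℝ∪{−∞} be nonzero, and let q : Fin n → ℝ. Define θ = (1/2)·max over i, j of ((B*)_{ij} + p_j − q_i). Then a vector x : Fin n → ℝ satisfies max_j (B_{ij} + x_j) ≤ x_i for all i and attains f(x) = θ if and only if there exists u : Fin n → ℝ such that for all i: p_i − θ ≤ u_i and for all j: (B*)_{ji} + u_i ≤ q_j + θ, and x_i = max over j of ((B*)_{ij} + u_j) for all i. -/

import Mathlib

open Finset

/-- Tropical (max-plus) matrix powers over `WithBot ℝ`: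
`B⁰ = I` (diagonal `0`, off-diagonal `⊥`), and
`(B^(k+1)) i j = max over l of (B i l + (B^k) l j)`. -/
noncomputable def tropPow {n : ℕ} (B : Fin n → Fin n → WithBot ℝ) :
    ℕ → Fin n → Fin n → WithBot ℝ
  | 0 => fun i j => if i = j then (0 : WithBot ℝ) else ⊥
  | k + 1 => fun i j => Finset.univ.sup fun l => B i l + tropPow B k l j

/-- Kleene star: `(B*) i j = max over 0 ≤ k ≤ n-1 of (B^k) i j`. -/
noncomputable def tropStar {n : ℕ} (B : Fin n → Fin n → WithBot ℝ) (i j : Fin n) : WithBot ℝ :=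
  (Finset.range n).sup fun k => tropPow B k i j

/-- The objective `f(x) = max( max_j (p_j - x_j), max_i (x_i - q_i) )` in `WithBot ℝ`. -/
noncomputable def tropObj {n : ℕ} (p : Fin n → WithBot ℝ) (q x : Fin n → ℝ) : WithBot ℝ :=
  (Finset.univ.sup fun j => p j + ((-(x j) : ℝ) : WithBot ℝ)) ⊔
  (Finset.univ.sup fun i => ((x i - q i : ℝ) : WithBot ℝ))

lemma tp_succ_le {n : ℕ} (B : Fin n → Fin n → WithBot ℝ) (k : ℕ) (i l j : Fin n) :
    B i l + tropPow B k l j ≤ tropPow B (k + 1) i j := by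
  show _ ≤ Finset.univ.sup fun l => B i l + tropPow B k l j
  exact Finset.le_sup (f := fun l => B i l + tropPow B k l j) (Finset.mem_univ l)

lemma tp_succ_ex {n : ℕ} (B : Fin n → Fin n → WithBot ℝ) (k : ℕ) (i j : Fin n) :
    ∃ l, tropPow B (k + 1) i j = B i l + tropPow B k l j := by
  obtain ⟨l, _, h⟩ := Finset.exists_mem_eq_sup Finset.univ ⟨i, Finset.mem_univ i⟩
    (fun l => B i l + tropPow B k l j)
  exact ⟨l, h⟩

lemma tp_comp {n : ℕ} (B : Fin n → Fin n → WithBot ℝ) (a b : ℕ) (i l j : Fin n) :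
    tropPow B a i l + tropPow B b l j ≤ tropPow B (a + b) i j := by
  induction a generalizing i with
  | zero =>
    by_cases h : i = l
    · subst h; simp [tropPow]
    · simp [tropPow, h]
  | succ a ih =>
    obtain ⟨m, hm⟩ := tp_succ_ex B a i l
    rw [hm, add_assoc, Nat.add_right_comm]
    exact (add_le_add_right (ih m) _).trans (tp_succ_le B _ i m j)

lemma tp_walk {n : ℕ} (B : Fin n → Fin n → WithBot ℝ) (m : ℕ) (i j : Fin n)
    (h : tropPow B m i j ≠ ⊥) : ∃ w : ℕ → Fin n, w 0 = i ∧ w m = j ∧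
      tropPow B m i j = ∑ t ∈ Finset.range m, B (w t) (w (t + 1)) := by
  induction m generalizing i with
  | zero =>
    by_cases hij : i = j
    · exact ⟨fun _ => i, rfl, hij, by simp [tropPow, hij]⟩
    · simp [tropPow, hij] at h
  | succ m ih =>
    obtain ⟨l, hl⟩ := tp_succ_ex B m i j
    have h2 : tropPow B m l j ≠ ⊥ := by
      intro h3
      rw [hl, h3] at h
      simp at h
    obtain ⟨w, h0, hm, hw⟩ := ih l h2
    refine ⟨fun t => Nat.casesOn t i w, rfl, hm, ?_⟩
    rw [hl, hw, Finset.sum_range_succ', add_comm]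
    simp [h0]

lemma tp_walk_le {n : ℕ} (B : Fin n → Fin n → WithBot ℝ) (w : ℕ → Fin n) (m a : ℕ) :
    ∑ t ∈ Finset.range m, B (w (a + t)) (w (a + t + 1)) ≤ tropPow B m (w a) (w (a + m)) := by
  induction m generalizing a with
  | zero => simp [tropPow]
  | succ m ih =>
    rw [Finset.sum_range_succ', add_comm]
    refine le_trans ?_ (tp_succ_le B m (w a) (w (a + 1)) _)
    have := ih (a + 1)
    have h := add_le_add_right this (B (w a) (w (a + 1)))
    have e : ∀ t, a + 1 + t = a + (t + 1) := fun t => by ring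
    rw [e m] at h
    refine le_trans (le_of_eq ?_) h
    refine congrArg₂ (· + ·) rfl (Finset.sum_congr rfl fun t _ => ?_)
    rw [e t]

lemma tp_le_star {n : ℕ} (B : Fin n → Fin n → WithBot ℝ)
    (hTr : ∀ i : Fin n, ∀ k : ℕ, 1 ≤ k → k ≤ n → tropPow B k i i ≤ 0)
    (k : ℕ) (hk : k ≤ n) (i j : Fin n) : tropPow B k i j ≤ tropStar B i j := by
  have key : ∀ k < n, tropPow B k i j ≤ tropStar B i j := fun k hk =>
    Finset.le_sup (f := fun k => tropPow B k i j) (Finset.mem_range.2 hk)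
  rcases hk.lt_or_eq with h | h
  · exact key k h
  subst h
  by_cases hb : tropPow B k i j = ⊥
  · rw [hb]; exact bot_le
  obtain ⟨w, h0, hm, hw⟩ := tp_walk B k i j hb
  obtain ⟨a, b, hab, hbk, hwab⟩ : ∃ a b, a < b ∧ b ≤ k ∧ w a = w b := by
    obtain ⟨x, y, hxy, he⟩ := Fintype.exists_ne_map_eq_of_card_lt
      (fun t : Fin (k + 1) => w t) (by simp)
    have hne : (x : ℕ) ≠ y := fun h => hxy (Fin.ext h)
    rcases lt_or_gt_of_ne hne with h | h
    · exact ⟨x, y, h, by omega, he⟩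
    · exact ⟨y, x, h, by omega, he.symm⟩
  obtain ⟨d, rfl⟩ := Nat.exists_eq_add_of_lt hab
  obtain ⟨e, he⟩ := Nat.exists_eq_add_of_le hbk
  have h1 := tp_walk_le B w a 0
  have h2 := tp_walk_le B w (d + 1) a
  have h3 := tp_walk_le B w e (a + (d + 1))
  have hz : tropPow B (d + 1) (w a) (w (a + (d + 1))) ≤ 0 := by
    have : w (a + (d + 1)) = w a := hwab.symm
    rw [this]
    exact hTr _ _ (by omega) (by omega)
  have hs : ∑ t ∈ Finset.range k, B (w t) (w (t + 1)) =
      ∑ t ∈ Finset.range a, B (w (0 + t)) (w (0 + t + 1)) +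
      ∑ t ∈ Finset.range (d + 1), B (w (a + t)) (w (a + t + 1)) +
      ∑ t ∈ Finset.range e, B (w (a + (d + 1) + t)) (w (a + (d + 1) + t + 1)) := by
    have : k = a + (d + 1) + e := by omega
    simp only [zero_add]
    conv_lhs => rw [this]
    rw [Finset.sum_range_add, Finset.sum_range_add]
  rw [hw, hs]
  have hk2 : a + (d + 1) + e = k := by omega
  rw [hk2, hm] at h3
  have hwd : w (a + (d + 1)) = w a := hwab.symm
  rw [hwd] at h3
  rw [zero_add, h0] at h1
  refine le_trans (add_le_add (add_le_add h1 (h2.trans hz)) h3) ?_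
  rw [add_zero]
  exact (tp_comp B a e i (w a) j).trans (key _ (by omega))

lemma tp_star_diag {n : ℕ} (B : Fin n → Fin n → WithBot ℝ) (i : Fin n) :
    0 ≤ tropStar B i i := by
  have := Finset.le_sup (f := fun k => tropPow B k i i)
    (Finset.mem_range.2 (Nat.zero_lt_of_lt i.2))
  simpa [tropPow, tropStar] using this

lemma tp_star_ex {n : ℕ} (B : Fin n → Fin n → WithBot ℝ) (i j : Fin n) :
    ∃ k < n, tropStar B i j = tropPow B k i j := by
  obtain ⟨k, hk, h⟩ := Finset.exists_mem_eq_sup (Finset.range n)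
    ⟨0, Finset.mem_range.2 (Nat.zero_lt_of_lt i.2)⟩ (fun k => tropPow B k i j)
  exact ⟨k, Finset.mem_range.1 hk, h⟩

lemma tp_mul_star {n : ℕ} (B : Fin n → Fin n → WithBot ℝ)
    (hTr : ∀ i : Fin n, ∀ k : ℕ, 1 ≤ k → k ≤ n → tropPow B k i i ≤ 0)
    (i l j : Fin n) : B i l + tropStar B l j ≤ tropStar B i j := by
  obtain ⟨k, hk, h⟩ := tp_star_ex B l j
  rw [h]
  exact (tp_succ_le B k i l j).trans (tp_le_star B hTr _ hk i j)

lemma tp_pow_sub {n : ℕ} (B : Fin n → Fin n → WithBot ℝ) (x : Fin n → WithBot ℝ)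
    (hx : ∀ i j, B i j + x j ≤ x i) (k : ℕ) (i j : Fin n) : tropPow B k i j + x j ≤ x i := by
  induction k generalizing i with
  | zero =>
    by_cases h : i = j
    · subst h; simp [tropPow]
    · simp [tropPow, h]
  | succ k ih =>
    obtain ⟨m, hm⟩ := tp_succ_ex B k i j
    rw [hm, add_assoc]
    exact (add_le_add_right (ih m) _).trans (hx i m)

lemma tp_star_sub {n : ℕ} (B : Fin n → Fin n → WithBot ℝ) (x : Fin n → WithBot ℝ)
    (hx : ∀ i j, B i j + x j ≤ x i) (i j : Fin n) : tropStar B i j + x j ≤ x i := by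
  obtain ⟨k, hk, h⟩ := tp_star_ex B i j
  rw [h]
  exact tp_pow_sub B x hx k i j

lemma wb_sub_le (a : WithBot ℝ) (b c : ℝ) :
    a + ((-b : ℝ) : WithBot ℝ) ≤ (c : WithBot ℝ) ↔ a + ((-c : ℝ) : WithBot ℝ) ≤ (b : WithBot ℝ) := by
  induction a with
  | bot => simp
  | coe a =>
    norm_cast
    constructor <;> intro h <;> linarith

theorem stmt3 {n : ℕ} (hn : 1 ≤ n) (B : Fin n → Fin n → WithBot ℝ)
    (hTr : ∀ i : Fin n, ∀ k : ℕ, 1 ≤ k → k ≤ n → tropPow B k i i ≤ 0)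
    (p : Fin n → WithBot ℝ) (hp : ∃ i, p i ≠ ⊥)
    (q : Fin n → ℝ)
    (θ : ℝ)
    (hθ : (θ : WithBot ℝ) =
      WithBot.map (fun r => r / 2)
        (Finset.univ.sup fun i => Finset.univ.sup fun j =>
          tropStar B i j + p j + ((-(q i) : ℝ) : WithBot ℝ))) :
    ∀ x : Fin n → ℝ,
      ((∀ i, (Finset.univ.sup fun j => B i j + ((x j : ℝ) : WithBot ℝ)) ≤ ((x i : ℝ) : WithBot ℝ)) ∧
       tropObj p q x = (θ : WithBot ℝ))
      ↔
      (∃ u : Fin n → ℝ,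
        (∀ i, p i + ((-θ : ℝ) : WithBot ℝ) ≤ ((u i : ℝ) : WithBot ℝ)) ∧
        (∀ i, ∀ j, tropStar B j i + ((u i : ℝ) : WithBot ℝ) ≤ ((q j + θ : ℝ) : WithBot ℝ)) ∧
        (∀ i, ((x i : ℝ) : WithBot ℝ) =
          Finset.univ.sup fun j => tropStar B i j + ((u j : ℝ) : WithBot ℝ))) := by
  intro x
  constructor
  · rintro ⟨hx, hf⟩
    have hx' : ∀ i j, B i j + (x j : WithBot ℝ) ≤ (x i : WithBot ℝ) := fun i j =>
      (Finset.le_sup (f := fun j => B i j + ((x j : ℝ) : WithBot ℝ)) (Finset.mem_univ j)).trans (hx i)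
    have hs := tp_star_sub B (fun i => (x i : WithBot ℝ)) hx'
    have hle := hf.le
    rw [tropObj, sup_le_iff, Finset.sup_le_iff, Finset.sup_le_iff] at hle
    refine ⟨x, fun i => ?_, fun i j => ?_, fun i => ?_⟩
    · exact (wb_sub_le _ _ _).1 (hle.1 i (Finset.mem_univ i))
    · refine (hs j i).trans ?_
      have := hle.2 j (Finset.mem_univ j)
      norm_cast at this ⊢
      linarith
    · apply le_antisymm
      · refine le_trans ?_ (Finset.le_sup (f := fun j => tropStar B i j + ((x j : ℝ) : WithBot ℝ))
          (Finset.mem_univ i))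
        simpa using add_le_add_left (tp_star_diag B i) (x i : WithBot ℝ)
      · exact Finset.sup_le fun j _ => hs i j
  · rintro ⟨u, hpu, hqu, hxu⟩
    have hx' : ∀ i j, B i j + (x j : WithBot ℝ) ≤ (x i : WithBot ℝ) := by
      intro i j
      obtain ⟨l, _, hl⟩ := Finset.exists_mem_eq_sup Finset.univ ⟨i, Finset.mem_univ i⟩
        (fun l => tropStar B j l + ((u l : ℝ) : WithBot ℝ))
      rw [hxu j, hl, hxu i, ← add_assoc]
      exact (add_le_add_left (tp_mul_star B hTr i j l) _).trans
        (Finset.le_sup (f := fun j => tropStar B i j + ((u j : ℝ) : WithBot ℝ)) (Finset.mem_univ l))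
    have hs := tp_star_sub B (fun i => (x i : WithBot ℝ)) hx'
    refine ⟨fun i => Finset.sup_le fun j _ => hx' i j, ?_⟩
    have hux : ∀ i, (u i : WithBot ℝ) ≤ (x i : WithBot ℝ) := by
      intro i
      rw [hxu i]
      refine le_trans ?_ (Finset.le_sup (f := fun j => tropStar B i j + ((u j : ℝ) : WithBot ℝ))
          (Finset.mem_univ i))
      simpa using add_le_add_left (tp_star_diag B i) (u i : WithBot ℝ)
    apply le_antisymm
    · refine sup_le (Finset.sup_le fun i _ => ?_) (Finset.sup_le fun i _ => ?_)
      · exact (wb_sub_le _ _ _).2 ((hpu i).trans (hux i))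
      · have : (x i : WithBot ℝ) ≤ ((q i + θ : ℝ) : WithBot ℝ) := by
          rw [hxu i]
          exact Finset.sup_le fun j _ => hqu j i
        norm_cast at this ⊢
        linarith
    · have i0 : Fin n := ⟨0, hn⟩
      obtain ⟨i, _, hi⟩ := Finset.exists_mem_eq_sup Finset.univ ⟨i0, Finset.mem_univ i0⟩
        (fun i => Finset.univ.sup fun j => tropStar B i j + p j + ((-(q i) : ℝ) : WithBot ℝ))
      obtain ⟨j, _, hj⟩ := Finset.exists_mem_eq_sup Finset.univ ⟨i0, Finset.mem_univ i0⟩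
        (fun j => tropStar B i j + p j + ((-(q i) : ℝ) : WithBot ℝ))
      rw [hi, hj] at hθ
      have h1 : p j + ((-(x j) : ℝ) : WithBot ℝ) ≤ tropObj p q x :=
        (Finset.le_sup (f := fun j => p j + ((-(x j) : ℝ) : WithBot ℝ)) (Finset.mem_univ j)).trans
          le_sup_left
      have h2 : ((x i - q i : ℝ) : WithBot ℝ) ≤ tropObj p q x :=
        (Finset.le_sup (f := fun i => ((x i - q i : ℝ) : WithBot ℝ)) (Finset.mem_univ i)).trans
          le_sup_right
      have h3 := hs i j
      generalize tropObj p q x = F at h1 h2 ⊢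
      generalize tropStar B i j = S at h3 hθ
      generalize p j = P at h1 hθ
      induction F with
      | bot => simp at h2
      | coe F =>
      induction S with
      | bot => simp at hθ
      | coe S =>
      induction P with
      | bot => simp at hθ
      | coe P =>
      norm_cast at h1 h2 h3
      rw [← WithBot.coe_add, ← WithBot.coe_add, WithBot.map_coe] at hθ
      norm_cast at hθ ⊢
      linarith
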